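/- arXiv:2408.05181 — 2 statements merged into one kernel-verified Lean document; each statement's English description precedes it below -/
import Mathlib

section
/- Let (H,A) be a compatible weak matched pair. Then ε is a counit on A♯♯H: for every x ∈ A and h ∈ H, (id⊗ε)Δ(x♯♯h) = x♯♯h = (ε⊗id)Δ(x♯♯h). Hence A♯♯H, with coproduct Δ and counit ε, is a coalgebra. -/
open TensorProduct

noncomputable section

namespace WeakSmash

variable (k : Type*) [Field k]

/-- A weak bialgebra structure on the `k`-algebra `H`. -/
structure WeakBialgebra (H : Type*) [Ring H] [Algebra k H] where
  comul : H →ₗ[k] H ⊗[k] H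
  counit : H →ₗ[k] k
  coassoc : ∀ h : H,
    (TensorProduct.assoc k H H H) ((LinearMap.rTensor H comul) (comul h)) =
      (LinearMap.lTensor H comul) (comul h)
  counit_comul : ∀ h : H,
    (TensorProduct.lid k H) ((LinearMap.rTensor H counit) (comul h)) = h
  comul_counit : ∀ h : H,
    (TensorProduct.rid k H) ((LinearMap.lTensor H counit) (comul h)) = h
  comul_mul : ∀ h g : H, comul (h * g) = comul h * comul g
  counit_weak : ∀ h g l : H,
    counit (h * g * l) =
      LinearMap.mul' k k
        ((TensorProduct.map (counit ∘ₗ LinearMap.mulLeft k h)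
            (counit ∘ₗ LinearMap.mulRight k l)) (comul g))
  counit_weak' : ∀ h g l : H,
    counit (h * g * l) =
      LinearMap.mul' k k
        ((TensorProduct.map (counit ∘ₗ LinearMap.mulLeft k h)
            (counit ∘ₗ LinearMap.mulRight k l)) ((TensorProduct.comm k H H) (comul g)))
  comul_one_left :
    ((TensorProduct.assoc k H H H) (comul 1 ⊗ₜ[k] (1 : H))) * ((1 : H) ⊗ₜ[k] comul 1) =
      (LinearMap.lTensor H comul) (comul 1)
  comul_one_right :
    ((1 : H) ⊗ₜ[k] comul 1) * ((TensorProduct.assoc k H H H) (comul 1 ⊗ₜ[k] (1 : H))) =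
      (LinearMap.lTensor H comul) (comul 1)

variable {k}

namespace WeakBialgebra

variable {H : Type*} [Ring H] [Algebra k H]

/-- The target counital map `εt h = ε(1₁ h) 1₂`. -/
def εt (W : WeakBialgebra k H) : H →ₗ[k] H :=
  (TensorProduct.lid k H).toLinearMap ∘ₗ LinearMap.rTensor H W.counit ∘ₗ
    LinearMap.mulLeft k (W.comul 1) ∘ₗ (TensorProduct.mk k H H).flip 1

/-- The source counital map `εs h = 1₁ ε(h 1₂)`. -/
def εs (W : WeakBialgebra k H) : H →ₗ[k] H :=
  (TensorProduct.rid k H).toLinearMap ∘ₗ LinearMap.lTensor H W.counit ∘ₗ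
    LinearMap.mulRight k (W.comul 1) ∘ₗ TensorProduct.mk k H H 1

/-- Cocommutativity of a weak bialgebra. -/
def Cocomm (W : WeakBialgebra k H) : Prop :=
  ∀ h : H, (TensorProduct.comm k H H) (W.comul h) = W.comul h

/-- `S` is an antipode for `W`, making it a weak Hopf algebra. -/
structure IsAntipode (W : WeakBialgebra k H) (S : H →ₗ[k] H) : Prop where
  mul_antipode : ∀ h : H,
    LinearMap.mul' k H ((LinearMap.lTensor H S) (W.comul h)) = W.εt h
  antipode_mul : ∀ h : H,
    LinearMap.mul' k H ((LinearMap.rTensor H S) (W.comul h)) = W.εs h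
  antipode_mid : ∀ h : H,
    LinearMap.mul' k H
      ((TensorProduct.map S (LinearMap.mul' k H ∘ₗ LinearMap.lTensor H S))
        ((LinearMap.lTensor H W.comul) (W.comul h))) = S h

/-- `α` is a left integral: `h α = εt(h) α`. -/
def IsLeftIntegral (W : WeakBialgebra k H) (α : H) : Prop :=
  ∀ h : H, h * α = W.εt h * α

end WeakBialgebra

section MatchedPair

variable (k)
variable {H A : Type*} [Ring H] [Algebra k H] [Ring A] [Algebra k A]

/-- `A` is a left `H`-module algebra via the action `act`. -/
structure IsModuleAlgebra (WH : WeakBialgebra k H) (act : H →ₗ[k] A →ₗ[k] A) : Prop where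
  one_act : ∀ a : A, act 1 a = a
  act_mul : ∀ (h : H) (a b : A),
    act h (a * b) =
      LinearMap.mul' k A ((TensorProduct.map (act.flip a) (act.flip b)) (WH.comul h))
  act_act : ∀ (h g : H) (a : A), act h (act g a) = act (h * g) a
  act_unit : ∀ h : H, act h 1 = act (WH.εt h) 1

/-- The map `h ↦ ε(h⁰) h¹`. -/
def coactCounit (WH : WeakBialgebra k H) (coact : H →ₗ[k] H ⊗[k] A) : H →ₗ[k] A :=
  (TensorProduct.lid k A).toLinearMap ∘ₗ LinearMap.rTensor A WH.counit ∘ₗ coact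

/-- `H` is a right `A`-comodule coalgebra via the coaction `coact`. -/
structure IsComoduleCoalgebra (WH : WeakBialgebra k H) (WA : WeakBialgebra k A)
    (coact : H →ₗ[k] H ⊗[k] A) : Prop where
  counit_coact : ∀ h : H,
    (TensorProduct.rid k H) ((LinearMap.lTensor H WA.counit) (coact h)) = h
  comul_coact : ∀ h : H,
    (LinearMap.rTensor A WH.comul) (coact h) =
      (LinearMap.lTensor (H ⊗[k] H) (LinearMap.mul' k A))
        ((TensorProduct.tensorTensorTensorComm k H A H A)
          ((TensorProduct.map coact coact) (WH.comul h)))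
  coact_coact : ∀ h : H,
    (TensorProduct.assoc k H A A) ((LinearMap.rTensor A coact) (coact h)) =
      (LinearMap.lTensor H WA.comul) (coact h)
  coact_counit : ∀ h : H,
    coactCounit k WH coact h = WA.εs (coactCounit k WH coact h)

/-- The map `(h₁ ⊗ h₂) ⊗ (x₁ ⊗ x₂) ↦ (h₁⁰ · x₁) ⊗ (h₁¹ (h₂ · x₂))`. -/
def pairMapA (act : H →ₗ[k] A →ₗ[k] A) (coact : H →ₗ[k] H ⊗[k] A) :
    (H ⊗[k] H) ⊗[k] (A ⊗[k] A) →ₗ[k] A ⊗[k] A :=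
  LinearMap.lTensor A (LinearMap.mul' k A) ∘ₗ
  (TensorProduct.assoc k A A A).toLinearMap ∘ₗ
  LinearMap.rTensor A
    (LinearMap.rTensor A (TensorProduct.lift act) ∘ₗ
      (TensorProduct.assoc k H A A).symm.toLinearMap ∘ₗ
      LinearMap.lTensor H (TensorProduct.comm k A A).toLinearMap ∘ₗ
      (TensorProduct.assoc k H A A).toLinearMap) ∘ₗ
  TensorProduct.map (LinearMap.rTensor A coact) (TensorProduct.lift act) ∘ₗ
  (TensorProduct.tensorTensorTensorComm k H H A A).toLinearMap

/-- The map `(h₁ ⊗ h₂) ⊗ (g⁰ ⊗ g¹) ↦ (h₁⁰ g⁰) ⊗ (h₁¹ (h₂ · g¹))`. -/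
def pairMapH (act : H →ₗ[k] A →ₗ[k] A) (coact : H →ₗ[k] H ⊗[k] A) :
    (H ⊗[k] H) ⊗[k] (H ⊗[k] A) →ₗ[k] H ⊗[k] A :=
  LinearMap.lTensor H (LinearMap.mul' k A) ∘ₗ
  (TensorProduct.assoc k H A A).toLinearMap ∘ₗ
  LinearMap.rTensor A
    (LinearMap.rTensor A (LinearMap.mul' k H) ∘ₗ
      (TensorProduct.assoc k H H A).symm.toLinearMap ∘ₗ
      LinearMap.lTensor H (TensorProduct.comm k A H).toLinearMap ∘ₗ
      (TensorProduct.assoc k H A H).toLinearMap) ∘ₗ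
  TensorProduct.map (LinearMap.rTensor H coact) (TensorProduct.lift act) ∘ₗ
  (TensorProduct.tensorTensorTensorComm k H H H A).toLinearMap

/-- The iterated comultiplication `h ↦ h₁ ⊗ (h₂ ⊗ h₃)`. -/
def twoComul (WH : WeakBialgebra k H) : H →ₗ[k] H ⊗[k] (H ⊗[k] H) :=
  LinearMap.lTensor H WH.comul ∘ₗ WH.comul

/-- The iterated comultiplication `h ↦ h₁ ⊗ (h₂ ⊗ (h₃ ⊗ h₄))`. -/
def threeComul (WH : WeakBialgebra k H) : H →ₗ[k] H ⊗[k] (H ⊗[k] (H ⊗[k] H)) :=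
  LinearMap.lTensor H (LinearMap.lTensor H WH.comul) ∘ₗ LinearMap.lTensor H WH.comul ∘ₗ WH.comul

/-- Left-hand side of the matched pair condition (iii):
`(h₁·x)₁ ⊗ (h₂ g)⁰ ⊗ (h₁·x)₂ (h₂ g)¹`. -/
def mpLHS (WH : WeakBialgebra k H) (WA : WeakBialgebra k A)
    (act : H →ₗ[k] A →ₗ[k] A) (coact : H →ₗ[k] H ⊗[k] A) (h g : H) (x : A) :
    (A ⊗[k] H) ⊗[k] A :=
  LinearMap.lTensor (A ⊗[k] H) (LinearMap.mul' k A)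
    ((TensorProduct.tensorTensorTensorComm k A A H A)
      ((TensorProduct.map (WA.comul ∘ₗ act.flip x) (coact ∘ₗ LinearMap.mulRight k g))
        (WH.comul h)))

/-- Right-hand side of the matched pair condition (iii):
`(h₁⁰ · x₁) ⊗ (h₃⁰ g⁰) ⊗ (h₁¹ (h₂ · x₂) h₃¹ (h₄ · g¹))`. -/
def mpRHS (WH : WeakBialgebra k H) (WA : WeakBialgebra k A)
    (act : H →ₗ[k] A →ₗ[k] A) (coact : H →ₗ[k] H ⊗[k] A) (h g : H) (x : A) :
    (A ⊗[k] H) ⊗[k] A :=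
  LinearMap.lTensor (A ⊗[k] H) (LinearMap.mul' k A)
    ((TensorProduct.tensorTensorTensorComm k A A H A)
      ((TensorProduct.map
          (pairMapA k act coact ∘ₗ
            (TensorProduct.mk k (H ⊗[k] H) (A ⊗[k] A)).flip (WA.comul x))
          (pairMapH k act coact ∘ₗ
            (TensorProduct.mk k (H ⊗[k] H) (H ⊗[k] A)).flip (coact g)))
        ((TensorProduct.assoc k H H (H ⊗[k] H)).symm (threeComul k WH h))))

/-- `(H, A)` is a weak matched pair. -/
structure IsWeakMatchedPair (WH : WeakBialgebra k H) (WA : WeakBialgebra k A)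
    (act : H →ₗ[k] A →ₗ[k] A) (coact : H →ₗ[k] H ⊗[k] A) : Prop where
  moduleAlgebra : IsModuleAlgebra k WH act
  comoduleCoalgebra : IsComoduleCoalgebra k WH WA coact
  cond3 : ∀ (h g : H) (x : A),
    mpLHS k WH WA act coact h g x = mpRHS k WH WA act coact h g x
  cond4 : ∀ (h : H) (x : A), WA.εs (act h x) = WA.εs (act h 1) * WA.εs x
  cond5 :
    (LinearMap.rTensor H coact) (WH.comul 1) =
      (TensorProduct.map (LinearMap.lTensor H (coactCounit k WH coact))
          (LinearMap.mul' k H))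
        ((TensorProduct.tensorTensorTensorComm k H H H H)
          (WH.comul 1 ⊗ₜ[k] WH.comul 1))

/-- `(H, A)` is a compatible (abelian) weak matched pair. -/
structure IsCompatiblePair (WH : WeakBialgebra k H) (WA : WeakBialgebra k A)
    (act : H →ₗ[k] A →ₗ[k] A) (coact : H →ₗ[k] H ⊗[k] A) : Prop where
  pair : IsWeakMatchedPair k WH WA act coact
  cocomm : WH.Cocomm
  comm : ∀ a b : A, a * b = b * a
  compat1 : ∀ h : H,
    act h 1 =
      (TensorProduct.rid k A)
        ((TensorProduct.map (TensorProduct.lift act)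
            (WA.counit ∘ₗ TensorProduct.lift act))
          ((TensorProduct.tensorTensorTensorComm k H H A A)
            (WH.comul h ⊗ₜ[k] WA.comul 1)))
  compat2 : ∀ h g : H,
    (TensorProduct.map (act h) (act g)) (WA.comul 1) =
      (TensorProduct.map (LinearMap.mulLeft k (act h 1))
        (LinearMap.mulLeft k (act g 1))) (WA.comul 1)

/-- The smash product multiplication on `A ⊗ H`:
`(x ⊗ h) (y ⊗ g) = x (h₁ · y) ⊗ h₂ g`. -/
def smashMul (WH : WeakBialgebra k H) (act : H →ₗ[k] A →ₗ[k] A) :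
    (A ⊗[k] H) ⊗[k] (A ⊗[k] H) →ₗ[k] A ⊗[k] H :=
  LinearMap.rTensor H (LinearMap.mul' k A) ∘ₗ
  (TensorProduct.assoc k A A H).symm.toLinearMap ∘ₗ
  LinearMap.lTensor A
    (TensorProduct.map (TensorProduct.lift act) (LinearMap.mul' k H) ∘ₗ
      (TensorProduct.tensorTensorTensorComm k H H A H).toLinearMap) ∘ₗ
  (TensorProduct.assoc k A (H ⊗[k] H) (A ⊗[k] H)).toLinearMap ∘ₗ
  LinearMap.rTensor (A ⊗[k] H) (LinearMap.lTensor A WH.comul)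

/-- The smash coproduct on `A ⊗ H`:
`Δ(x ⊗ h) = (x₁ ⊗ h₁⁰) ⊗ (x₂ h₁¹ ⊗ h₂)`. -/
def smashComul (WH : WeakBialgebra k H) (WA : WeakBialgebra k A)
    (coact : H →ₗ[k] H ⊗[k] A) :
    A ⊗[k] H →ₗ[k] (A ⊗[k] H) ⊗[k] (A ⊗[k] H) :=
  (TensorProduct.assoc k (A ⊗[k] H) A H).toLinearMap ∘ₗ
  LinearMap.rTensor H (LinearMap.lTensor (A ⊗[k] H) (LinearMap.mul' k A)) ∘ₗ
  LinearMap.rTensor H (TensorProduct.tensorTensorTensorComm k A A H A).toLinearMap ∘ₗ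
  (TensorProduct.assoc k (A ⊗[k] A) (H ⊗[k] A) H).symm.toLinearMap ∘ₗ
  LinearMap.lTensor (A ⊗[k] A) (LinearMap.rTensor H coact) ∘ₗ
  TensorProduct.map WA.comul WH.comul

/-- The smash counit `ε(x ⊗ h) = ε(x) ε(h)`. -/
def smashCounit (WH : WeakBialgebra k H) (WA : WeakBialgebra k A) :
    A ⊗[k] H →ₗ[k] k :=
  LinearMap.mul' k k ∘ₗ TensorProduct.map WA.counit WH.counit

/-- The projection `u ↦ u (1_A # 1_H)` onto `A ♯ H`. -/
def projUnder (WH : WeakBialgebra k H) (act : H →ₗ[k] A →ₗ[k] A) :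
    A ⊗[k] H →ₗ[k] A ⊗[k] H :=
  smashMul k WH act ∘ₗ
    (TensorProduct.mk k (A ⊗[k] H) (A ⊗[k] H)).flip ((1 : A) ⊗ₜ[k] (1 : H))

/-- The projection `u ↦ (id ⊗ ε) Δ(u)` onto `overline(A # H)`. -/
def projBar (WH : WeakBialgebra k H) (WA : WeakBialgebra k A)
    (coact : H →ₗ[k] H ⊗[k] A) : A ⊗[k] H →ₗ[k] A ⊗[k] H :=
  (TensorProduct.rid k (A ⊗[k] H)).toLinearMap ∘ₗ
    LinearMap.lTensor (A ⊗[k] H) (smashCounit k WH WA) ∘ₗ smashComul k WH WA coact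

/-- The projection onto `A ♯♯ H`, i.e. `u ↦ (id ⊗ ε) Δ (u (1#1))`. -/
def projBoth (WH : WeakBialgebra k H) (WA : WeakBialgebra k A)
    (act : H →ₗ[k] A →ₗ[k] A) (coact : H →ₗ[k] H ⊗[k] A) :
    A ⊗[k] H →ₗ[k] A ⊗[k] H :=
  projBar k WH WA coact ∘ₗ projUnder k WH act

/-- Componentwise smash multiplication on `(A⊗H) ⊗ (A⊗H)`. -/
def smashMul2 (WH : WeakBialgebra k H) (act : H →ₗ[k] A →ₗ[k] A) :
    ((A ⊗[k] H) ⊗[k] (A ⊗[k] H)) ⊗[k] ((A ⊗[k] H) ⊗[k] (A ⊗[k] H)) →ₗ[k]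
      (A ⊗[k] H) ⊗[k] (A ⊗[k] H) :=
  TensorProduct.map (smashMul k WH act) (smashMul k WH act) ∘ₗ
    (TensorProduct.tensorTensorTensorComm k (A ⊗[k] H) (A ⊗[k] H)
      (A ⊗[k] H) (A ⊗[k] H)).toLinearMap

/-- Componentwise smash multiplication on threefold tensors. -/
def smashMul3 (WH : WeakBialgebra k H) (act : H →ₗ[k] A →ₗ[k] A) :
    ((A ⊗[k] H) ⊗[k] ((A ⊗[k] H) ⊗[k] (A ⊗[k] H))) ⊗[k]
      ((A ⊗[k] H) ⊗[k] ((A ⊗[k] H) ⊗[k] (A ⊗[k] H))) →ₗ[k]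
      (A ⊗[k] H) ⊗[k] ((A ⊗[k] H) ⊗[k] (A ⊗[k] H)) :=
  TensorProduct.map (smashMul k WH act) (smashMul2 k WH act) ∘ₗ
    (TensorProduct.tensorTensorTensorComm k (A ⊗[k] H)
      ((A ⊗[k] H) ⊗[k] (A ⊗[k] H)) (A ⊗[k] H)
      ((A ⊗[k] H) ⊗[k] (A ⊗[k] H))).toLinearMap

/-- The unit element `1_A ♯♯ 1_H` of `A ♯♯ H`. -/
def smashOne (WH : WeakBialgebra k H) (WA : WeakBialgebra k A)
    (act : H →ₗ[k] A →ₗ[k] A) (coact : H →ₗ[k] H ⊗[k] A) : A ⊗[k] H :=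
  projBoth k WH WA act coact ((1 : A) ⊗ₜ[k] (1 : H))

/-- The map `εt` of the weak bialgebra `A ♯♯ H`: `u ↦ ε(e₁ u) e₂` where `e = 1_A ♯♯ 1_H`. -/
def smashEpsT (WH : WeakBialgebra k H) (WA : WeakBialgebra k A)
    (act : H →ₗ[k] A →ₗ[k] A) (coact : H →ₗ[k] H ⊗[k] A) (u : A ⊗[k] H) :
    A ⊗[k] H :=
  (TensorProduct.lid k (A ⊗[k] H))
    ((LinearMap.rTensor (A ⊗[k] H)
        (smashCounit k WH WA ∘ₗ smashMul k WH act ∘ₗ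
          (TensorProduct.mk k (A ⊗[k] H) (A ⊗[k] H)).flip u))
      (smashComul k WH WA coact (smashOne k WH WA act coact)))

/-- The map `εs` of the weak bialgebra `A ♯♯ H`: `u ↦ e₁ ε(u e₂)` where `e = 1_A ♯♯ 1_H`. -/
def smashEpsS (WH : WeakBialgebra k H) (WA : WeakBialgebra k A)
    (act : H →ₗ[k] A →ₗ[k] A) (coact : H →ₗ[k] H ⊗[k] A) (u : A ⊗[k] H) :
    A ⊗[k] H :=
  (TensorProduct.rid k (A ⊗[k] H))
    ((LinearMap.lTensor (A ⊗[k] H)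
        (smashCounit k WH WA ∘ₗ smashMul k WH act ∘ₗ
          TensorProduct.mk k (A ⊗[k] H) (A ⊗[k] H) u))
      (smashComul k WH WA coact (smashOne k WH WA act coact)))

/-- The antipode of `A ♯♯ H`:
`S(x ⊗ h) = (1_A ♯♯ S_H(h⁰)) ((S_A(x h¹)) ♯♯ 1_H)`. -/
def smashAntipode (WH : WeakBialgebra k H) (WA : WeakBialgebra k A)
    (act : H →ₗ[k] A →ₗ[k] A) (coact : H →ₗ[k] H ⊗[k] A)
    (SH : H →ₗ[k] H) (SA : A →ₗ[k] A) : A ⊗[k] H →ₗ[k] A ⊗[k] H :=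
  smashMul k WH act ∘ₗ
  TensorProduct.map
    (projBoth k WH WA act coact ∘ₗ TensorProduct.mk k A H 1)
    (projBoth k WH WA act coact ∘ₗ (TensorProduct.mk k A H).flip 1) ∘ₗ
  (TensorProduct.comm k A H).toLinearMap ∘ₗ
  TensorProduct.map (SA ∘ₗ LinearMap.mul' k A) SH ∘ₗ
  (TensorProduct.assoc k A A H).symm.toLinearMap ∘ₗ
  LinearMap.lTensor A ((TensorProduct.comm k H A).toLinearMap ∘ₗ coact)

/-- LHS of condition (7): `(1_{H1} h⁰ · 1_A) ⊗ S_A(h¹) εs(1_{H2}¹) ⊗ 1_{H2}⁰`. -/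
def cond7LHS (WH : WeakBialgebra k H) (WA : WeakBialgebra k A)
    (act : H →ₗ[k] A →ₗ[k] A) (coact : H →ₗ[k] H ⊗[k] A)
    (SA : A →ₗ[k] A) (h : H) : (A ⊗[k] A) ⊗[k] H :=
  (TensorProduct.assoc k A A H).symm
    ((TensorProduct.map
        (act.flip 1 ∘ₗ LinearMap.mul' k H)
        ((TensorProduct.comm k H A).toLinearMap ∘ₗ
          LinearMap.lTensor H
            (LinearMap.mul' k A ∘ₗ TensorProduct.map SA WA.εs ∘ₗ
              (TensorProduct.comm k A A).toLinearMap) ∘ₗ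
          (TensorProduct.assoc k H A A).toLinearMap ∘ₗ
          LinearMap.rTensor A coact))
      ((TensorProduct.tensorTensorTensorComm k H H H A)
        (WH.comul 1 ⊗ₜ[k] coact h)))

/-- RHS of condition (7):
`εt(1_{H1}⁰ h⁰ · 1_A) ⊗ εt(h¹) εs(1_{H2}¹) 1_{H1}¹ ⊗ 1_{H2}⁰`. -/
def cond7RHS (WH : WeakBialgebra k H) (WA : WeakBialgebra k A)
    (act : H →ₗ[k] A →ₗ[k] A) (coact : H →ₗ[k] H ⊗[k] A) (h : H) :
    (A ⊗[k] A) ⊗[k] H :=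
  (TensorProduct.assoc k A A H).symm
   ((LinearMap.lTensor A (TensorProduct.comm k H A).toLinearMap)
    ((TensorProduct.assoc k A H A)
     ((LinearMap.lTensor (A ⊗[k] H)
        (LinearMap.mul' k A ∘ₗ (TensorProduct.comm k A A).toLinearMap))
      ((TensorProduct.tensorTensorTensorComm k A A H A)
       ((LinearMap.lTensor (A ⊗[k] A) (TensorProduct.comm k A H).toLinearMap)
        ((TensorProduct.map
            (LinearMap.rTensor A (WA.εt ∘ₗ act.flip 1 ∘ₗ LinearMap.mul' k H) ∘ₗ
              (TensorProduct.assoc k H H A).symm.toLinearMap ∘ₗ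
              LinearMap.lTensor H (TensorProduct.comm k A H).toLinearMap ∘ₗ
              (TensorProduct.assoc k H A H).toLinearMap)
            (LinearMap.rTensor H
                (LinearMap.mul' k A ∘ₗ (TensorProduct.comm k A A).toLinearMap ∘ₗ
                  TensorProduct.map WA.εs WA.εt) ∘ₗ
              (TensorProduct.assoc k A A H).symm.toLinearMap ∘ₗ
              LinearMap.lTensor A (TensorProduct.comm k H A).toLinearMap ∘ₗ
              (TensorProduct.assoc k A H A).toLinearMap ∘ₗ
              LinearMap.rTensor A (TensorProduct.comm k H A).toLinearMap))
          ((TensorProduct.tensorTensorTensorComm k (H ⊗[k] A) (H ⊗[k] A) H A)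
            (((TensorProduct.map coact coact) (WH.comul 1)) ⊗ₜ[k] coact h))))))))

/-- LHS of condition (8):
`εs(h₁¹ h₂¹) (S_H(h₁⁰) · 1_A) ⊗ S_H(h₂⁰) h₃`. -/
def cond8LHS (WH : WeakBialgebra k H) (WA : WeakBialgebra k A)
    (act : H →ₗ[k] A →ₗ[k] A) (coact : H →ₗ[k] H ⊗[k] A)
    (SH : H →ₗ[k] H) (h : H) : A ⊗[k] H :=
  LinearMap.rTensor H (LinearMap.mul' k A)
   ((TensorProduct.assoc k A A H).symm
    ((TensorProduct.map
        (WA.εs ∘ₗ LinearMap.mul' k A)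
        (TensorProduct.map (act.flip 1 ∘ₗ SH)
          (LinearMap.mul' k H ∘ₗ LinearMap.rTensor H SH)))
      ((TensorProduct.tensorTensorTensorComm k A H A (H ⊗[k] H))
        ((TensorProduct.map (TensorProduct.comm k H A).toLinearMap
            ((TensorProduct.assoc k A H H).toLinearMap ∘ₗ
              LinearMap.rTensor H (TensorProduct.comm k H A).toLinearMap))
          ((TensorProduct.map coact (LinearMap.rTensor H coact))
            (twoComul k WH h))))))

/-- RHS of condition (8):
`εs(h¹ 1_{H2}¹) εs(h⁰ 1_{H1} · 1_A) ⊗ 1_{H2}⁰`. -/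
def cond8RHS (WH : WeakBialgebra k H) (WA : WeakBialgebra k A)
    (act : H →ₗ[k] A →ₗ[k] A) (coact : H →ₗ[k] H ⊗[k] A) (h : H) :
    A ⊗[k] H :=
  LinearMap.rTensor H (LinearMap.mul' k A ∘ₗ (TensorProduct.comm k A A).toLinearMap)
   ((TensorProduct.assoc k A A H).symm
    ((TensorProduct.map
        (WA.εs ∘ₗ act.flip 1 ∘ₗ LinearMap.mul' k H)
        (LinearMap.rTensor H (WA.εs ∘ₗ LinearMap.mul' k A) ∘ₗ
          (TensorProduct.assoc k A A H).symm.toLinearMap ∘ₗ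
          LinearMap.lTensor A (TensorProduct.comm k H A).toLinearMap))
      ((TensorProduct.tensorTensorTensorComm k H A H (H ⊗[k] A))
        (coact h ⊗ₜ[k] (LinearMap.lTensor H coact) (WH.comul 1)))))

/-- The element `εs(t₁¹ (t₂ · 1_A)) ⊗ t₁⁰` of `A ⊗ H`. -/
def integralWitness (WH : WeakBialgebra k H) (WA : WeakBialgebra k A)
    (act : H →ₗ[k] A →ₗ[k] A) (coact : H →ₗ[k] H ⊗[k] A) (t : H) :
    A ⊗[k] H :=
  (TensorProduct.comm k H A)
    ((LinearMap.lTensor H (WA.εs ∘ₗ LinearMap.mul' k A))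
      ((TensorProduct.assoc k H A A)
        ((LinearMap.rTensor A coact)
          ((LinearMap.lTensor H (act.flip 1)) (WH.comul t)))))

end MatchedPair

end WeakSmash


namespace WeakSmash

section Counit

variable {k H A : Type*} [Field k] [Ring H] [Algebra k H] [Ring A] [Algebra k A]

/-- `εs a` lies in the source base: `Δ(εs a) = Δ(1) (1 ⊗ εs a)`. -/
lemma comul_εs (W : WeakBialgebra k A) (a : A) :
    W.comul (W.εs a) = W.comul 1 * ((1 : A) ⊗ₜ[k] W.εs a) := by
  let F : A ⊗[k] (A ⊗[k] A) →ₗ[k] A ⊗[k] A :=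
    LinearMap.lTensor A ((TensorProduct.rid k A).toLinearMap ∘ₗ
      LinearMap.lTensor A (W.counit ∘ₗ LinearMap.mulLeft k a))
  have hεs : W.εs a = (TensorProduct.rid k A)
      (LinearMap.lTensor A (W.counit ∘ₗ LinearMap.mulLeft k a) (W.comul 1)) := by
    simp only [WeakBialgebra.εs, LinearMap.comp_apply, LinearMap.mulRight_apply,
      TensorProduct.mk_apply, LinearEquiv.coe_coe]
    congr 1
    induction W.comul 1 using TensorProduct.induction_on with
    | zero => simp
    | add u v hu hv => simp only [mul_add, map_add, hu, hv]
    | tmul u v => simp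
  have hl : ∀ w : A ⊗[k] A,
      W.comul ((TensorProduct.rid k A)
        (LinearMap.lTensor A (W.counit ∘ₗ LinearMap.mulLeft k a) w)) =
      F ((TensorProduct.assoc k A A A) (LinearMap.rTensor A W.comul w)) := by
    intro w
    induction w using TensorProduct.induction_on with
    | zero => simp
    | add u v hu hv => simp only [map_add, hu, hv]
    | tmul u v =>
      simp only [LinearMap.lTensor_tmul, LinearMap.rTensor_tmul, TensorProduct.rid_tmul,
        map_smul]
      induction W.comul u using TensorProduct.induction_on with
      | zero => simp
      | add p q hp hq => simp only [smul_add, TensorProduct.add_tmul, map_add, hp, hq]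
      | tmul p q => simp [F]
  have hr : ∀ v w : A ⊗[k] A,
      F (((TensorProduct.assoc k A A A) (v ⊗ₜ[k] (1 : A))) * ((1 : A) ⊗ₜ[k] w)) =
      v * ((1 : A) ⊗ₜ[k] (TensorProduct.rid k A)
        (LinearMap.lTensor A (W.counit ∘ₗ LinearMap.mulLeft k a) w)) := by
    intro v w
    induction v using TensorProduct.induction_on with
    | zero => simp
    | add p q hp hq => simp only [TensorProduct.add_tmul, map_add, add_mul, hp, hq]
    | tmul p q =>
      induction w using TensorProduct.induction_on with
      | zero => simp
      | add u v hu hv => simp only [TensorProduct.tmul_add, map_add, mul_add, hu, hv]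
      | tmul u v => simp [F]
  rw [hεs, hl, W.coassoc, ← W.comul_one_left, hr]

/-- The map `(a ⊗ b) ⊗ (g ⊗ c) ↦ ε(b c) (a ⊗ g)`. -/
def pairing (WA : WeakBialgebra k A) :
    (A ⊗[k] A) ⊗[k] (H ⊗[k] A) →ₗ[k] A ⊗[k] H :=
  (TensorProduct.rid k (A ⊗[k] H)).toLinearMap ∘ₗ
    LinearMap.lTensor (A ⊗[k] H) (WA.counit ∘ₗ LinearMap.mul' k A) ∘ₗ
    (TensorProduct.tensorTensorTensorComm k A A H A).toLinearMap

@[simp]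
lemma pairing_tmul (WA : WeakBialgebra k A) (a b c : A) (g : H) :
    pairing WA ((a ⊗ₜ[k] b) ⊗ₜ[k] (g ⊗ₜ[k] c)) = WA.counit (b * c) • (a ⊗ₜ[k] g) := by
  simp [pairing]

/-- `(id ⊗ ε) Δ (y ⊗ h) = ε(y₂ h¹) (y₁ ⊗ h⁰)`. -/
lemma projBar_tmul (WH : WeakBialgebra k H) (WA : WeakBialgebra k A)
    (coact : H →ₗ[k] H ⊗[k] A) (y : A) (h : H) :
    projBar k WH WA coact (y ⊗ₜ[k] h) = pairing WA (WA.comul y ⊗ₜ[k] coact h) := by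
  conv_rhs => rw [← WH.comul_counit h]
  simp only [projBar, smashComul, LinearMap.comp_apply, TensorProduct.map_tmul]
  induction WH.comul h using TensorProduct.induction_on with
  | zero => simp
  | add u v hu hv => simp only [TensorProduct.tmul_add, map_add, hu, hv]
  | tmul g g' =>
    simp only [LinearMap.lTensor_tmul, LinearMap.rTensor_tmul, TensorProduct.rid_tmul, map_smul,
      TensorProduct.tmul_smul, LinearEquiv.coe_coe, TensorProduct.assoc_symm_tmul]
    induction WA.comul y using TensorProduct.induction_on with
    | zero => simp
    | add u v hu hv => simp only [TensorProduct.add_tmul, map_add, smul_add, hu, hv]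
    | tmul a b =>
      induction coact g using TensorProduct.induction_on with
      | zero => simp
      | add u v hu hv =>
        simp only [TensorProduct.tmul_add, TensorProduct.add_tmul, map_add, smul_add, hu, hv]
      | tmul f c => simp [smashCounit, smul_smul, mul_comm]

/-- The left counit projection `u ↦ (ε ⊗ id) Δ(u)`. -/
def projLeft (WH : WeakBialgebra k H) (WA : WeakBialgebra k A)
    (coact : H →ₗ[k] H ⊗[k] A) : A ⊗[k] H →ₗ[k] A ⊗[k] H :=
  (TensorProduct.lid k (A ⊗[k] H)).toLinearMap ∘ₗ
    LinearMap.rTensor (A ⊗[k] H) (smashCounit k WH WA) ∘ₗ smashComul k WH WA coact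

/-- `(ε ⊗ id) Δ (y ⊗ h) = y ε(h₁⁰) h₁¹ ⊗ h₂`. -/
lemma projLeft_tmul (WH : WeakBialgebra k H) (WA : WeakBialgebra k A)
    (coact : H →ₗ[k] H ⊗[k] A) (y : A) (h : H) :
    projLeft WH WA coact (y ⊗ₜ[k] h) =
      LinearMap.rTensor H (LinearMap.mulLeft k y ∘ₗ coactCounit k WH coact) (WH.comul h) := by
  conv_rhs => rw [← WA.counit_comul y]
  simp only [projLeft, smashComul, LinearMap.comp_apply, TensorProduct.map_tmul]
  induction WH.comul h using TensorProduct.induction_on with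
  | zero => simp
  | add u v hu hv => simp only [TensorProduct.tmul_add, map_add, hu, hv]
  | tmul g g' =>
    simp only [LinearMap.lTensor_tmul, LinearMap.rTensor_tmul, coactCounit, LinearMap.comp_apply,
      LinearEquiv.coe_coe, TensorProduct.assoc_symm_tmul, LinearMap.mulLeft_apply]
    induction WA.comul y using TensorProduct.induction_on with
    | zero => simp
    | add u v hu hv => simp only [TensorProduct.add_tmul, map_add, add_mul, hu, hv]
    | tmul a b =>
      induction coact g using TensorProduct.induction_on with
      | zero => simp
      | add u v hu hv =>
        simp only [TensorProduct.tmul_add, TensorProduct.add_tmul, map_add, mul_add, hu, hv]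
      | tmul f c => simp [smashCounit, smul_smul, TensorProduct.smul_tmul', mul_comm]

/-- The projection `projBar` is idempotent. -/
lemma projBar_projBar (WH : WeakBialgebra k H) (WA : WeakBialgebra k A)
    (coact : H →ₗ[k] H ⊗[k] A) (hC : IsComoduleCoalgebra k WH WA coact) (u : A ⊗[k] H) :
    projBar k WH WA coact (projBar k WH WA coact u) = projBar k WH WA coact u := by
  let G : (A ⊗[k] (A ⊗[k] A)) ⊗[k] (H ⊗[k] (A ⊗[k] A)) →ₗ[k] A ⊗[k] H :=
    (TensorProduct.rid k (A ⊗[k] H)).toLinearMap ∘ₗ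
      LinearMap.lTensor (A ⊗[k] H)
        (LinearMap.mul' k k ∘ₗ TensorProduct.map WA.counit WA.counit ∘ₗ
          LinearMap.mul' k (A ⊗[k] A)) ∘ₗ
      (TensorProduct.tensorTensorTensorComm k A (A ⊗[k] A) H (A ⊗[k] A)).toLinearMap
  have hl : ∀ (t : A ⊗[k] A) (s : H ⊗[k] A),
      projBar k WH WA coact (pairing WA (t ⊗ₜ[k] s)) =
        G ((TensorProduct.assoc k A A A) (LinearMap.rTensor A WA.comul t) ⊗ₜ[k]
          (TensorProduct.assoc k H A A) (LinearMap.rTensor A coact s)) := by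
    intro t s
    induction t using TensorProduct.induction_on with
    | zero => simp
    | add u v hu hv => simp only [TensorProduct.add_tmul, map_add, hu, hv]
    | tmul a b =>
      induction s using TensorProduct.induction_on with
      | zero => simp
      | add u v hu hv => simp only [TensorProduct.tmul_add, map_add, hu, hv]
      | tmul g c =>
        rw [pairing_tmul, map_smul, projBar_tmul, LinearMap.rTensor_tmul, LinearMap.rTensor_tmul]
        induction WA.comul a using TensorProduct.induction_on with
        | zero => simp
        | add u v hu hv => simp only [TensorProduct.add_tmul, map_add, smul_add, hu, hv]
        | tmul p q =>
          induction coact g using TensorProduct.induction_on with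
          | zero => simp
          | add u v hu hv =>
            simp only [TensorProduct.tmul_add, TensorProduct.add_tmul, map_add, smul_add, hu, hv]
          | tmul f d => simp [G, smul_smul, mul_comm]
  have hcounit : ∀ w : A, LinearMap.mul' k k
      (TensorProduct.map WA.counit WA.counit (WA.comul w)) = WA.counit w := by
    intro w
    conv_rhs => rw [← WA.counit_comul w]
    induction WA.comul w using TensorProduct.induction_on with
    | zero => simp
    | add u v hu hv => simp only [map_add, hu, hv]
    | tmul p q => simp
  have hr : ∀ (t : A ⊗[k] A) (s : H ⊗[k] A),
      G (LinearMap.lTensor A WA.comul t ⊗ₜ[k] LinearMap.lTensor H WA.comul s) =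
        pairing WA (t ⊗ₜ[k] s) := by
    intro t s
    induction t using TensorProduct.induction_on with
    | zero => simp
    | add u v hu hv => simp only [TensorProduct.add_tmul, map_add, hu, hv]
    | tmul a b =>
      induction s using TensorProduct.induction_on with
      | zero => simp
      | add u v hu hv => simp only [TensorProduct.tmul_add, map_add, hu, hv]
      | tmul g c => simp [G, ← WA.comul_mul, hcounit]
  induction u using TensorProduct.induction_on with
  | zero => simp
  | add u v hu hv => simp only [map_add, hu, hv]
  | tmul y h => rw [projBar_tmul, hl, WA.coassoc, hC.coact_coact, hr]

/-- `ε(h₁⁰) h₁¹ h₂¹ ⊗ h₂⁰ = h¹ ⊗ h⁰`. -/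
lemma coactCounit_mul_coact (WH : WeakBialgebra k H) (WA : WeakBialgebra k A)
    (coact : H →ₗ[k] H ⊗[k] A) (hC : IsComoduleCoalgebra k WH WA coact) (h : H) :
    LinearMap.mul' k (H ⊗[k] A)
      (TensorProduct.map (TensorProduct.mk k H A 1 ∘ₗ coactCounit k WH coact) coact
        (WH.comul h)) = coact h := by
  let F : (H ⊗[k] H) ⊗[k] A →ₗ[k] H ⊗[k] A :=
    LinearMap.rTensor A ((TensorProduct.lid k H).toLinearMap ∘ₗ LinearMap.rTensor H WH.counit)
  have h1 : ∀ s : H ⊗[k] A, F (LinearMap.rTensor A WH.comul s) = s := by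
    intro s
    induction s using TensorProduct.induction_on with
    | zero => simp
    | add u v hu hv => simp only [map_add, hu, hv]
    | tmul g c => simp [F, WH.counit_comul]
  rw [← h1 (coact h), hC.comul_coact]
  induction WH.comul h using TensorProduct.induction_on with
  | zero => simp
  | add u v hu hv => simp only [map_add, hu, hv]
  | tmul g g' =>
    simp only [TensorProduct.map_tmul, coactCounit, LinearMap.comp_apply, LinearEquiv.coe_coe]
    induction coact g using TensorProduct.induction_on with
    | zero => simp
    | add u v hu hv => simp only [TensorProduct.add_tmul, map_add, hu, hv]
    | tmul f c =>
      induction coact g' using TensorProduct.induction_on with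
      | zero => simp
      | add u v hu hv => simp only [TensorProduct.tmul_add, map_add, hu, hv]
      | tmul f' c' => simp [F, TensorProduct.smul_tmul']

/-- `ε(h⁰⁰) h⁰¹ ⊗ h¹ = Δ(ε(h⁰) h¹)`. -/
lemma rTensor_coactCounit_coact (WH : WeakBialgebra k H) (WA : WeakBialgebra k A)
    (coact : H →ₗ[k] H ⊗[k] A) (hC : IsComoduleCoalgebra k WH WA coact) (h : H) :
    LinearMap.rTensor A (coactCounit k WH coact) (coact h) =
      WA.comul (coactCounit k WH coact h) := by
  let F : H ⊗[k] (A ⊗[k] A) →ₗ[k] A ⊗[k] A :=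
    (TensorProduct.lid k (A ⊗[k] A)).toLinearMap ∘ₗ LinearMap.rTensor (A ⊗[k] A) WH.counit
  have hl : ∀ s : H ⊗[k] A, LinearMap.rTensor A (coactCounit k WH coact) s =
      F ((TensorProduct.assoc k H A A) (LinearMap.rTensor A coact s)) := by
    intro s
    induction s using TensorProduct.induction_on with
    | zero => simp
    | add u v hu hv => simp only [map_add, hu, hv]
    | tmul g c =>
      simp only [LinearMap.rTensor_tmul, coactCounit, LinearMap.comp_apply, LinearEquiv.coe_coe]
      induction coact g using TensorProduct.induction_on with
      | zero => simp
      | add u v hu hv => simp only [TensorProduct.add_tmul, map_add, hu, hv]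
      | tmul f d => simp [F, TensorProduct.smul_tmul']
  rw [hl, hC.coact_coact]
  simp only [coactCounit, LinearMap.comp_apply, LinearEquiv.coe_coe]
  induction coact h using TensorProduct.induction_on with
  | zero => simp
  | add u v hu hv => simp only [map_add, hu, hv]
  | tmul g c => simp [F]

/-- The left counit projection fixes the range of `projBar`. -/
lemma projLeft_projBar (WH : WeakBialgebra k H) (WA : WeakBialgebra k A)
    (coact : H →ₗ[k] H ⊗[k] A) (hC : IsComoduleCoalgebra k WH WA coact) (u : A ⊗[k] H) :
    projLeft WH WA coact (projBar k WH WA coact u) = projBar k WH WA coact u := by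
  let Ψ : (A ⊗[k] A) ⊗[k] ((H ⊗[k] H) ⊗[k] A) →ₗ[k] A ⊗[k] H :=
    (TensorProduct.rid k (A ⊗[k] H)).toLinearMap ∘ₗ
      TensorProduct.map
        (LinearMap.rTensor H (LinearMap.mul' k A ∘ₗ
          LinearMap.lTensor A (coactCounit k WH coact)) ∘ₗ
          (TensorProduct.assoc k A H H).symm.toLinearMap)
        (WA.counit ∘ₗ LinearMap.mul' k A) ∘ₗ
      (TensorProduct.tensorTensorTensorComm k A A (H ⊗[k] H) A).toLinearMap
  have hl : ∀ (t : A ⊗[k] A) (s : H ⊗[k] A),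
      projLeft WH WA coact (pairing WA (t ⊗ₜ[k] s)) =
        Ψ (t ⊗ₜ[k] LinearMap.rTensor A WH.comul s) := by
    intro t s
    induction t using TensorProduct.induction_on with
    | zero => simp
    | add u v hu hv => simp only [TensorProduct.add_tmul, map_add, hu, hv]
    | tmul a b =>
      induction s using TensorProduct.induction_on with
      | zero => simp
      | add u v hu hv => simp only [TensorProduct.tmul_add, map_add, hu, hv]
      | tmul g c =>
        rw [pairing_tmul, map_smul, projLeft_tmul, LinearMap.rTensor_tmul]
        induction WH.comul g using TensorProduct.induction_on with
        | zero => simp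
        | add u v hu hv =>
          simp only [TensorProduct.tmul_add, TensorProduct.add_tmul, map_add, smul_add, hu, hv]
        | tmul p q => simp [Ψ]
  have hm : ∀ (t : A ⊗[k] A) (s s' : H ⊗[k] A),
      Ψ (t ⊗ₜ[k] (LinearMap.lTensor (H ⊗[k] H) (LinearMap.mul' k A)
        ((TensorProduct.tensorTensorTensorComm k H A H A) (s ⊗ₜ[k] s')))) =
      pairing WA ((t * LinearMap.rTensor A (coactCounit k WH coact) s) ⊗ₜ[k] s') := by
    intro t s s'
    induction t using TensorProduct.induction_on with
    | zero => simp
    | add u v hu hv => simp only [TensorProduct.add_tmul, map_add, add_mul, hu, hv]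
    | tmul a b =>
      induction s using TensorProduct.induction_on with
      | zero => simp
      | add u v hu hv =>
        simp only [TensorProduct.tmul_add, TensorProduct.add_tmul, map_add, mul_add, hu, hv]
      | tmul g c =>
        induction s' using TensorProduct.induction_on with
        | zero => simp
        | add u v hu hv => simp only [TensorProduct.tmul_add, map_add, hu, hv]
        | tmul g' c' => simp [Ψ, mul_assoc]
  have hp : ∀ (t : A ⊗[k] A) (a : A) (s : H ⊗[k] A),
      pairing WA ((t * ((1 : A) ⊗ₜ[k] a)) ⊗ₜ[k] s) =
        pairing WA (t ⊗ₜ[k] (((1 : H) ⊗ₜ[k] a) * s)) := by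
    intro t a s
    induction t using TensorProduct.induction_on with
    | zero => simp
    | add u v hu hv => simp only [TensorProduct.add_tmul, map_add, add_mul, hu, hv]
    | tmul p q =>
      induction s using TensorProduct.induction_on with
      | zero => simp
      | add u v hu hv => simp only [TensorProduct.tmul_add, map_add, mul_add, hu, hv]
      | tmul g c => simp [mul_assoc]
  induction u using TensorProduct.induction_on with
  | zero => simp
  | add u v hu hv => simp only [map_add, hu, hv]
  | tmul y h =>
    rw [projBar_tmul, hl, hC.comul_coact]
    conv_rhs => rw [← coactCounit_mul_coact WH WA coact hC h]
    induction WH.comul h using TensorProduct.induction_on with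
    | zero => simp
    | add u v hu hv => simp only [TensorProduct.tmul_add, map_add, hu, hv]
    | tmul g g' =>
      rw [TensorProduct.map_tmul, hm, rTensor_coactCounit_coact WH WA coact hC,
        hC.coact_counit g, comul_εs, ← hC.coact_counit g, ← mul_assoc, ← WA.comul_mul, mul_one,
        hp]
      simp

end Counit

theorem both_counit
    {k H A : Type*} [Field k] [Ring H] [Algebra k H] [Ring A] [Algebra k A]
    (WH : WeakBialgebra k H) (WA : WeakBialgebra k A)
    (act : H →ₗ[k] A →ₗ[k] A) (coact : H →ₗ[k] H ⊗[k] A)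
    (hCP : IsCompatiblePair k WH WA act coact) :
    ∀ (x : A) (h : H),
      (TensorProduct.rid k (A ⊗[k] H))
          ((LinearMap.lTensor (A ⊗[k] H) (smashCounit k WH WA))
            (smashComul k WH WA coact (projBoth k WH WA act coact (x ⊗ₜ[k] h)))) =
        projBoth k WH WA act coact (x ⊗ₜ[k] h) ∧
      (TensorProduct.lid k (A ⊗[k] H))
          ((LinearMap.rTensor (A ⊗[k] H) (smashCounit k WH WA))
            (smashComul k WH WA coact (projBoth k WH WA act coact (x ⊗ₜ[k] h)))) =
        projBoth k WH WA act coact (x ⊗ₜ[k] h) := by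
  intro x h
  have hC := hCP.pair.comoduleCoalgebra
  exact ⟨projBar_projBar WH WA coact hC _, projLeft_projBar WH WA coact hC _⟩

end WeakSmash
end
end

section
/- Let (H,A) be a compatible weak matched pair. Then the two projections on A#H commute: for all x ∈ A, h ∈ H, (id⊗ε)Δ((x#h)(1_A#1_H)) = ((id⊗ε)Δ(x#h))(1_A#1_H); that is, x♯♯h = x₁ε(x₂h¹)♯h⁰. -/
open TensorProduct

noncomputable section

namespace WeakSmash

variable {k H A : Type*} [Field k] [Ring H] [Algebra k H] [Ring A] [Algebra k A]

namespace WeakBialgebra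

/-- The contraction `a ⊗ b ↦ ε(b z) a`. -/
def contract (W : WeakBialgebra k A) (z : A) : A ⊗[k] A →ₗ[k] A :=
  (TensorProduct.rid k A).toLinearMap ∘ₗ
    LinearMap.lTensor A (W.counit ∘ₗ LinearMap.mulRight k z)

@[simp]
lemma contract_tmul (W : WeakBialgebra k A) (z a b : A) :
    W.contract z (a ⊗ₜ[k] b) = W.counit (b * z) • a := by
  simp [contract]

lemma contract_one_comul (W : WeakBialgebra k A) (x : A) : W.contract 1 (W.comul x) = x := by
  have h : W.counit ∘ₗ LinearMap.mulRight k (1 : A) = W.counit := by ext; simp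
  simpa [contract, h] using W.comul_counit x

lemma εs_eq_contract (W : WeakBialgebra k A) (hA : ∀ a b : A, a * b = b * a) (z : A) :
    W.εs z = W.contract z (W.comul 1) := by
  simp only [εs, LinearMap.comp_apply, LinearMap.mulRight_apply, TensorProduct.mk_apply]
  induction W.comul 1 with
  | zero => simp
  | add s t hs ht => rw [mul_add, map_add, map_add, hs, ht, map_add]
  | tmul a b => simp [hA z b]

/-- In a commutative weak bialgebra, `ε(x₂ z) x₁ = x εs(z)`. -/
lemma contract_comul (W : WeakBialgebra k A) (hA : ∀ a b : A, a * b = b * a) (z x : A) :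
    W.contract z (W.comul x) = x * W.εs z := by
  obtain ⟨U, hU⟩ := TensorProduct.exists_finset (W.comul 1)
  let Ψ : A ⊗[k] (A ⊗[k] A) →ₗ[k] A :=
    W.contract 1 ∘ₗ LinearMap.mulRight k (W.comul x) ∘ₗ LinearMap.lTensor A (W.contract z)
  have hΨ (a b c : A) : Ψ (a ⊗ₜ[k] (b ⊗ₜ[k] c)) =
      W.counit (c * z) • W.contract 1 (a ⊗ₜ[k] b * W.comul x) := by
    simp [Ψ]
  have h1 : Ψ (LinearMap.lTensor A W.comul (W.comul 1)) = x * W.εs z := by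
    have key (t : A ⊗[k] A) (c : A) :
        Ψ ((TensorProduct.assoc k A A A) (t ⊗ₜ[k] c)) =
          W.counit (c * z) • W.contract 1 (t * W.comul x) := by
      induction t with
      | zero => simp
      | add s t hs ht => rw [add_tmul, map_add, map_add, hs, ht, add_mul, map_add, smul_add]
      | tmul a b => rw [TensorProduct.assoc_tmul, hΨ]
    rw [← W.coassoc, W.εs_eq_contract hA, hU]
    simp only [map_sum, LinearMap.rTensor_tmul, key, ← W.comul_mul, contract_one_comul,
      contract_tmul, Finset.mul_sum]
    refine Finset.sum_congr rfl fun i _ => ?_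
    rw [hA i.1 x, mul_smul_comm]
  have h2 : Ψ (((TensorProduct.assoc k A A A) (W.comul 1 ⊗ₜ[k] (1 : A))) *
      ((1 : A) ⊗ₜ[k] W.comul 1)) = W.contract z (W.comul x) := by
    have key (a b : A) (t : A ⊗[k] A) :
        ∑ j ∈ U, W.counit (j.2 * z) • W.contract 1 (a ⊗ₜ[k] (b * j.1) * t) =
          W.contract z (a ⊗ₜ[k] b * t) := by
      induction t with
      | zero => simp
      | add s t hs ht => simp only [mul_add, map_add, smul_add, Finset.sum_add_distrib, hs, ht]
      | tmul p q =>
        have hw := W.counit_weak (b * q) 1 z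
        simp only [hU, map_sum, TensorProduct.map_tmul, LinearMap.comp_apply,
          LinearMap.mulLeft_apply, LinearMap.mulRight_apply, LinearMap.mul'_apply, mul_one] at hw
        simp only [Algebra.TensorProduct.tmul_mul_tmul, contract_tmul, mul_one, smul_smul, hw,
          Finset.sum_smul]
        refine Finset.sum_congr rfl fun j _ => ?_
        rw [mul_comm, mul_assoc, hA j.1 q, mul_assoc]
    rw [← one_mul x, W.comul_mul, hU]
    simp only [TensorProduct.sum_tmul, TensorProduct.tmul_sum, map_sum, Finset.sum_mul,
      Finset.mul_sum, TensorProduct.assoc_tmul, Algebra.TensorProduct.tmul_mul_tmul, one_mul,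
      mul_one, hΨ]
    rw [Finset.sum_comm]
    simp only [key]
  rw [← h2, W.comul_one_left, h1]

/-- In a commutative weak bialgebra, `εs(x εs(y)) = εs(x) εs(y)`. -/
lemma εs_mul_εs (W : WeakBialgebra k A) (hA : ∀ a b : A, a * b = b * a) (x y : A) :
    W.εs (x * W.εs y) = W.εs x * W.εs y := by
  let Ψ : A ⊗[k] (A ⊗[k] A) →ₗ[k] A := W.contract x ∘ₗ LinearMap.lTensor A (W.contract y)
  have h1 (t : A ⊗[k] A) :
      Ψ (LinearMap.lTensor A W.comul t) = W.contract (x * W.εs y) t := by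
    induction t with
    | zero => simp
    | add s t hs ht => simp only [map_add, hs, ht]
    | tmul a b => simp [Ψ, W.contract_comul hA, mul_assoc, hA x]
  have h2 (t : A ⊗[k] A) :
      Ψ (TensorProduct.assoc k A A A (LinearMap.rTensor A W.comul t)) =
        W.contract x (W.comul (W.contract y t)) := by
    induction t with
    | zero => simp
    | add s t hs ht => simp only [map_add, hs, ht]
    | tmul a b =>
      rw [LinearMap.rTensor_tmul, contract_tmul, map_smul, map_smul]
      induction W.comul a with
      | zero => simp
      | add s t hs ht => simp only [map_add, add_tmul, smul_add, hs, ht]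
      | tmul c d => simp [Ψ, smul_smul]
  rw [W.εs_eq_contract hA (x * W.εs y), ← h1, ← W.coassoc, h2, W.contract_comul hA,
    ← W.εs_eq_contract hA, hA]

lemma counit_mul_εs (W : WeakBialgebra k A) (hA : ∀ a b : A, a * b = b * a) (x y : A) :
    W.counit (x * W.εs y) = W.counit (x * y) := by
  have h (t : A ⊗[k] A) : W.counit (W.contract y t) =
      W.counit (TensorProduct.lid k A (LinearMap.rTensor A W.counit t) * y) := by
    induction t with
    | zero => simp
    | add s t hs ht => simp only [map_add, add_mul, hs, ht]
    | tmul a b => simp [mul_comm]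
  rw [← W.contract_comul hA, h, W.counit_comul]

/-- In a commutative weak bialgebra, `εs` is multiplicative. -/
lemma εs_mul (W : WeakBialgebra k A) (hA : ∀ a b : A, a * b = b * a) (x y : A) :
    W.εs (x * y) = W.εs x * W.εs y := by
  rw [← W.εs_mul_εs hA, W.εs_eq_contract hA, W.εs_eq_contract hA]
  induction W.comul 1 with
  | zero => simp
  | add s t hs ht => rw [map_add, map_add, hs, ht]
  | tmul a b =>
    rw [contract_tmul, contract_tmul, ← mul_assoc, ← mul_assoc, W.counit_mul_εs hA]

end WeakBialgebra

section Coaction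

variable {WH : WeakBialgebra k H} {WA : WeakBialgebra k A} {coact : H →ₗ[k] H ⊗[k] A}

/-- `ε(d⁰) ε(d¹₂ y) d¹₁ = ε(d⁰) d¹ εs(y)`. -/
lemma coactCounit_contract (hC : IsComoduleCoalgebra k WH WA coact)
    (hA : ∀ a b : A, a * b = b * a) (y : A) (d : H) :
    (TensorProduct.rid k A) ((TensorProduct.map (coactCounit k WH coact)
      (WA.counit ∘ₗ LinearMap.mulLeft k y)) (coact d)) =
      coactCounit k WH coact d * WA.εs y := by
  let Ψ : H ⊗[k] (A ⊗[k] A) →ₗ[k] A :=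
    (TensorProduct.lid k A).toLinearMap ∘ₗ TensorProduct.map WH.counit (WA.contract y)
  have h1 (t : H ⊗[k] A) : Ψ (LinearMap.lTensor H WA.comul t) =
      (TensorProduct.lid k A) (LinearMap.rTensor A WH.counit t) * WA.εs y := by
    induction t with
    | zero => simp
    | add s t hs ht => simp only [map_add, hs, ht, add_mul]
    | tmul a b => simp [Ψ, WA.contract_comul hA]
  have h2 (t : H ⊗[k] A) : Ψ (TensorProduct.assoc k H A A (LinearMap.rTensor A coact t)) =
      (TensorProduct.rid k A) ((TensorProduct.map (coactCounit k WH coact)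
        (WA.counit ∘ₗ LinearMap.mulLeft k y)) t) := by
    induction t with
    | zero => simp
    | add s t hs ht => simp only [map_add, hs, ht]
    | tmul a b =>
      simp only [LinearMap.rTensor_tmul, TensorProduct.map_tmul, coactCounit,
        LinearMap.comp_apply]
      induction coact a with
      | zero => simp
      | add s t hs ht => simp only [map_add, add_tmul, hs, ht]
      | tmul c e => simp [Ψ, hA y b, smul_smul, mul_comm]
  rw [← h2, hC.coact_coact, h1]
  rfl

/-- `h⁰ ⊗ εs(h¹) = h₁ ⊗ ε(h₂⁰) h₂¹`. -/
lemma lTensor_εs_coact (hC : IsComoduleCoalgebra k WH WA coact)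
    (hA : ∀ a b : A, a * b = b * a) (h : H) :
    LinearMap.lTensor H WA.εs (coact h) =
      LinearMap.lTensor H (coactCounit k WH coact) (WH.comul h) := by
  obtain ⟨U, hU⟩ := TensorProduct.exists_finset (WH.comul h)
  have hl : LinearMap.lTensor H WA.εs (coact h) =
      ∑ i ∈ U, LinearMap.lTensor H
        (LinearMap.mulRight k (coactCounit k WH coact i.2) ∘ₗ WA.εs) (coact i.1) := by
    let Ψ : (H ⊗[k] H) ⊗[k] A →ₗ[k] H ⊗[k] A :=
      TensorProduct.map ((TensorProduct.rid k H).toLinearMap ∘ₗ LinearMap.lTensor H WH.counit)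
        WA.εs
    have h1 (t : H ⊗[k] A) :
        Ψ (LinearMap.rTensor A WH.comul t) = LinearMap.lTensor H WA.εs t := by
      induction t with
      | zero => simp
      | add s t hs ht => simp only [map_add, hs, ht]
      | tmul a b => simp [Ψ, WH.comul_counit]
    have h2 (t : H ⊗[k] A) (d : H) :
        Ψ (LinearMap.lTensor (H ⊗[k] H) (LinearMap.mul' k A)
          (TensorProduct.tensorTensorTensorComm k H A H A (t ⊗ₜ[k] coact d))) =
        LinearMap.lTensor H (LinearMap.mulRight k (coactCounit k WH coact d) ∘ₗ WA.εs) t := by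
      rw [hC.coact_counit d]
      simp only [coactCounit, LinearMap.comp_apply]
      induction coact d with
      | zero => simp
      | add u v hu hv =>
        simp only [map_add, tmul_add, hu, hv]
        rw [← LinearMap.add_apply, ← LinearMap.lTensor_add]
        congr 2
        ext; simp [mul_add]
      | tmul c e =>
        induction t with
        | zero => simp
        | add s t hs ht => simp only [map_add, add_tmul, hs, ht]
        | tmul a b => simp [Ψ, WA.εs_mul hA, smul_tmul]
    rw [← h1, hC.comul_coact, hU]
    simp only [map_sum, TensorProduct.map_tmul, h2]
  have hr : LinearMap.lTensor H (coactCounit k WH coact) (WH.comul h) =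
      ∑ i ∈ U, LinearMap.lTensor H
        (LinearMap.mulRight k (coactCounit k WH coact i.2) ∘ₗ WA.εs) (coact i.1) := by
    let Ψ : (H ⊗[k] H) ⊗[k] A →ₗ[k] H ⊗[k] A :=
      (TensorProduct.rid k (H ⊗[k] A)).toLinearMap ∘ₗ
        TensorProduct.map (LinearMap.lTensor H (coactCounit k WH coact)) WA.counit
    have h1 (t : H ⊗[k] A) : Ψ (LinearMap.rTensor A WH.comul t) =
        LinearMap.lTensor H (coactCounit k WH coact)
          (WH.comul (TensorProduct.rid k H (LinearMap.lTensor H WA.counit t))) := by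
      induction t with
      | zero => simp
      | add s t hs ht => simp only [map_add, hs, ht]
      | tmul a b => simp [Ψ]
    have h2 (t : H ⊗[k] A) (d : H) :
        Ψ (LinearMap.lTensor (H ⊗[k] H) (LinearMap.mul' k A)
          (TensorProduct.tensorTensorTensorComm k H A H A (t ⊗ₜ[k] coact d))) =
        LinearMap.lTensor H (LinearMap.mulRight k (coactCounit k WH coact d) ∘ₗ WA.εs) t := by
      induction t with
      | zero => simp
      | add s t hs ht => simp only [map_add, add_tmul, hs, ht]
      | tmul a b =>
        have hb := coactCounit_contract hC hA b d
        rw [LinearMap.lTensor_tmul, LinearMap.comp_apply (LinearMap.mulRight k _),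
          LinearMap.mulRight_apply, hA, ← hb]
        induction coact d with
        | zero => simp
        | add u v hu hv => simp only [map_add, tmul_add, hu, hv]
        | tmul c e => simp [Ψ]
    conv_lhs => rw [← hC.counit_coact h]
    rw [← h1, hC.comul_coact, hU]
    simp only [map_sum, TensorProduct.map_tmul, h2]
  rw [hl, hr]

end Coaction

/-- The operator `y ⊗ h ↦ y f(h₁) ⊗ h₂` on `A ⊗ H`. -/
def twist (WH : WeakBialgebra k H) (f : H →ₗ[k] A) : A ⊗[k] H →ₗ[k] A ⊗[k] H :=
  LinearMap.rTensor H (LinearMap.mul' k A) ∘ₗ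
    (TensorProduct.assoc k A A H).symm.toLinearMap ∘ₗ
    LinearMap.lTensor A (LinearMap.rTensor H f ∘ₗ WH.comul)

lemma twist_tmul (WH : WeakBialgebra k H) (f : H →ₗ[k] A) (y : A) (h : H) :
    twist WH f (y ⊗ₜ[k] h) = LinearMap.rTensor H (LinearMap.mulLeft k y ∘ₗ f) (WH.comul h) := by
  simp only [twist, LinearMap.comp_apply, LinearMap.lTensor_tmul]
  induction WH.comul h with
  | zero => simp
  | add s t hs ht => simp only [map_add, tmul_add, hs, ht]
  | tmul a b => simp

lemma twist_comm {WH : WeakBialgebra k H} (hH : WH.Cocomm) (hA : ∀ a b : A, a * b = b * a)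
    (f g : H →ₗ[k] A) (y : A) (h : H) :
    twist WH f (twist WH g (y ⊗ₜ[k] h)) = twist WH g (twist WH f (y ⊗ₜ[k] h)) := by
  let Φ (f g : H →ₗ[k] A) : H ⊗[k] (H ⊗[k] H) →ₗ[k] A ⊗[k] H :=
    LinearMap.rTensor H (LinearMap.mulLeft k y ∘ₗ LinearMap.mul' k A) ∘ₗ
      (TensorProduct.assoc k A A H).symm.toLinearMap ∘ₗ
      TensorProduct.map f (LinearMap.rTensor H g)
  have h1 (f g : H →ₗ[k] A) : twist WH g (twist WH f (y ⊗ₜ[k] h)) =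
      Φ f g (LinearMap.lTensor H WH.comul (WH.comul h)) := by
    rw [twist_tmul]
    induction WH.comul h with
    | zero => simp
    | add s t hs ht => simp only [map_add, hs, ht]
    | tmul a b =>
      simp only [LinearMap.rTensor_tmul, LinearMap.lTensor_tmul, twist_tmul]
      induction WH.comul b with
      | zero => simp
      | add s t hs ht => simp only [map_add, tmul_add, hs, ht]
      | tmul c d => simp [Φ]
  have h2 (t : H ⊗[k] H) : Φ g f (TensorProduct.assoc k H H H (LinearMap.rTensor H WH.comul t)) =
      Φ f g (TensorProduct.assoc k H H H (LinearMap.rTensor H WH.comul t)) := by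
    induction t with
    | zero => simp
    | add s t hs ht => simp only [map_add, hs, ht]
    | tmul a b =>
      rw [LinearMap.rTensor_tmul]
      conv_lhs => rw [← hH a]
      induction WH.comul a with
      | zero => simp
      | add s t hs ht => simp only [map_add, add_tmul, hs, ht]
      | tmul c d => simp [Φ, hA (g d)]
  rw [h1, h1, ← WH.coassoc, h2]

set_option synthInstance.maxHeartbeats 200000 in
set_option maxHeartbeats 1000000 in
lemma projUnder_eq_twist (WH : WeakBialgebra k H) (act : H →ₗ[k] A →ₗ[k] A) :
    projUnder k WH act = twist WH (act.flip 1) := by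
  ext y h
  simp only [TensorProduct.AlgebraTensorModule.curry_apply, TensorProduct.curry_apply,
    LinearMap.coe_restrictScalars, twist_tmul]
  simp only [projUnder, smashMul, LinearMap.comp_apply, LinearMap.flip_apply,
    TensorProduct.mk_apply, LinearMap.rTensor_tmul, LinearMap.lTensor_tmul]
  induction WH.comul h with
  | zero => simp
  | add s t hs ht => simp only [map_add, tmul_add, add_tmul, hs, ht]
  | tmul a b => simp

set_option synthInstance.maxHeartbeats 200000 in
set_option maxHeartbeats 2000000 in
lemma projBar_eq_twist {WH : WeakBialgebra k H} {WA : WeakBialgebra k A}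
    {coact : H →ₗ[k] H ⊗[k] A} (hC : IsComoduleCoalgebra k WH WA coact)
    (hH : WH.Cocomm) (hA : ∀ a b : A, a * b = b * a) :
    projBar k WH WA coact = twist WH (coactCounit k WH coact) := by
  ext y h
  simp only [TensorProduct.AlgebraTensorModule.curry_apply, TensorProduct.curry_apply,
    LinearMap.coe_restrictScalars, twist_tmul]
  have hr : LinearMap.rTensor H (LinearMap.mulLeft k y ∘ₗ coactCounit k WH coact) (WH.comul h) =
      TensorProduct.comm k H A (LinearMap.lTensor H (LinearMap.mulLeft k y)
        (LinearMap.lTensor H WA.εs (coact h))) := by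
    rw [lTensor_εs_coact hC hA]
    conv_lhs => rw [← hH h]
    induction WH.comul h with
    | zero => simp
    | add s t hs ht => simp only [map_add, hs, ht]
    | tmul a b => simp
  have h1 (t : H ⊗[k] H) :
      (TensorProduct.rid k (A ⊗[k] H)) (LinearMap.lTensor (A ⊗[k] H) (smashCounit k WH WA)
        ((TensorProduct.assoc k (A ⊗[k] H) A H)
          (LinearMap.rTensor H (LinearMap.lTensor (A ⊗[k] H) (LinearMap.mul' k A))
            (LinearMap.rTensor H (TensorProduct.tensorTensorTensorComm k A A H A).toLinearMap
              ((TensorProduct.assoc k (A ⊗[k] A) (H ⊗[k] A) H).symm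
                (WA.comul y ⊗ₜ[k] LinearMap.rTensor H coact t)))))) =
      TensorProduct.comm k H A (LinearMap.lTensor H (LinearMap.mulLeft k y)
        (LinearMap.lTensor H WA.εs (coact
          (TensorProduct.rid k H (LinearMap.lTensor H WH.counit t))))) := by
    induction t with
    | zero => simp
    | add s t hs ht => simp only [map_add, tmul_add, hs, ht]
    | tmul a b =>
      simp only [LinearMap.rTensor_tmul, LinearMap.lTensor_tmul, TensorProduct.rid_tmul, map_smul]
      induction coact a with
      | zero => simp
      | add s t hs ht => simp only [map_add, tmul_add, add_tmul, smul_add, hs, ht]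
      | tmul c e =>
        simp only [LinearMap.lTensor_tmul, TensorProduct.comm_tmul, LinearMap.mulLeft_apply,
          ← WA.contract_comul hA]
        induction WA.comul y with
        | zero => simp
        | add s t hs ht => simp only [map_add, add_tmul, smul_add, hs, ht]
        | tmul p q => simp [smashCounit, smul_tmul', smul_smul, mul_comm]
  rw [hr]
  conv_rhs => rw [← WH.comul_counit h]
  rw [← h1]
  rfl

end WeakSmash

namespace WeakSmash

theorem projections_commute
    {k H A : Type*} [Field k] [Ring H] [Algebra k H] [Ring A] [Algebra k A]
    (WH : WeakBialgebra k H) (WA : WeakBialgebra k A)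
    (act : H →ₗ[k] A →ₗ[k] A) (coact : H →ₗ[k] H ⊗[k] A)
    (hCP : IsCompatiblePair k WH WA act coact) :
    ∀ (x : A) (h : H),
      projBar k WH WA coact (projUnder k WH act (x ⊗ₜ[k] h)) =
        projUnder k WH act (projBar k WH WA coact (x ⊗ₜ[k] h)) := by
  intro x h
  obtain ⟨hP, hH, hA, -, -⟩ := hCP
  rw [projUnder_eq_twist, projBar_eq_twist hP.comoduleCoalgebra hH hA]
  exact twist_comm hH hA _ _ x h

end WeakSmash
end
end
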